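/- For every integer n ≥ 1 and every real λ with 0 < λ ≤ 1/2, the secrecy rank of the origami distribution b^{(n,λ)} (viewed as a distribution on the finite sets {0,…,2^{⌊n/2⌋+2}−1} × {0,…,2^{⌈n/2⌉+1}−1} × {0,…,2^{n+1}−1}) equals 2: Srk(b^{(n,λ)}) = 2. In particular, for every z in the support of the Z-marginal, any auxiliary variable W making X and Y conditionally independent given (Z,W) must take at least two values with positive probability given Z = z, and the choice W = (parity of X) attains the value 2. -/

import Mathlib

/-- The "fold" permutation σ_t : shifts odd values by ±t (within blocks of size 2t),
fixes even values. -/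
def origamiSig (t k : ℕ) : ℕ :=
  if k % 2 = 1 then (if k % (2 * t) < t then k + t else k - t) else k

/-- The map producing the new block `T_n` from `S_n`. -/
def origamiFold (n : ℕ) (s : Finset (ℕ × ℕ × ℕ)) : Finset (ℕ × ℕ × ℕ) :=
  if n % 2 = 1 then
    s.image (fun p =>
      (p.1 + 2 ^ ((n + 3) / 2), origamiSig (2 ^ ((n + 1) / 2)) p.2.1, p.2.2 + 2 ^ (n + 1)))
  else
    s.image (fun p =>
      (origamiSig (2 ^ (n / 2 + 1)) p.1, p.2.1 + 2 ^ (n / 2 + 1), p.2.2 + 2 ^ (n + 1)))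

/-- The support `S_n` of the origami distribution. -/
def origamiS : ℕ → Finset (ℕ × ℕ × ℕ)
  | 0 => ∅
  | 1 => {(0,0,0), (1,1,0), (3,0,1), (2,1,1), (0,2,2), (3,3,2), (2,3,3), (1,2,3)}
  | (n + 2) => origamiS (n + 1) ∪ origamiFold (n + 1) (origamiS (n + 1))

/-- The origami distribution `b^{(n,λ)}` on ℕ³: probability `2^{-(n+1)}·λ` on points of
`S_n` with even `x`, `2^{-(n+1)}·(1-λ)` on points of `S_n` with odd `x`, and `0` elsewhere. -/
noncomputable def origamiB (n : ℕ) (lam : ℝ) (p : ℕ × ℕ × ℕ) : ℝ :=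
  if p ∈ origamiS n then (if p.1 % 2 = 0 then lam else 1 - lam) / 2 ^ (n + 1) else 0

open scoped Classical in
/-- The **secrecy rank** of a probability distribution `p` on `𝒳 × 𝒴 × 𝒵`: the minimum,
over all `m ≥ 1` and all extensions `q` of `p` by an auxiliary variable `W` with values
in `Fin m` making `X` and `Y` conditionally independent given `(Z,W)`, of the maximum
over `z` in the support of the `Z`-marginal of the number of values `w` with
`q_{ZW}(z,w) > 0`. -/
noncomputable def Srk {X Y Z : Type*} [Fintype X] [Fintype Y] [Fintype Z]
    (p : X → Y → Z → ℝ) : ℕ :=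
  sInf { r : ℕ | ∃ m : ℕ, 1 ≤ m ∧ ∃ q : X → Y → Z → Fin m → ℝ,
    (∀ x y z w, 0 ≤ q x y z w) ∧
    (∀ x y z, ∑ w, q x y z w = p x y z) ∧
    (∀ x y z w, q x y z w * (∑ x', ∑ y', q x' y' z w) =
      (∑ y', q x y' z w) * (∑ x', q x' y z w)) ∧
    r = (Finset.univ.filter fun z : Z => 0 < ∑ x, ∑ y, p x y z).sup
      (fun z => (Finset.univ.filter fun w : Fin m => 0 < ∑ x, ∑ y, q x y z w).card) }

/-- The origami distribution `b^{(n,λ)}` viewed as a distribution on the finite sets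
`{0,…,2^{⌊n/2⌋+2}-1} × {0,…,2^{⌈n/2⌉+1}-1} × {0,…,2^{n+1}-1}`. -/
noncomputable def origamiPFin (n : ℕ) (lam : ℝ)
    (x : Fin (2 ^ (n / 2 + 2))) (y : Fin (2 ^ ((n + 1) / 2 + 1)))
    (z : Fin (2 ^ (n + 1))) : ℝ :=
  origamiB n lam ((x : ℕ), (y : ℕ), (z : ℕ))

/-- The auxiliary extension of `origamiPFin` by `W = (parity of X)`. -/
noncomputable def origamiQPar (n : ℕ) (lam : ℝ)
    (x : Fin (2 ^ (n / 2 + 2))) (y : Fin (2 ^ ((n + 1) / 2 + 1)))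
    (z : Fin (2 ^ (n + 1))) (w : Fin 2) : ℝ :=
  if (x : ℕ) % 2 = (w : ℕ) then origamiPFin n lam x y z else 0

theorem origamiSig_mod_two {t : ℕ} (ht : t % 2 = 0) (k : ℕ) : origamiSig t k % 2 = k % 2 := by
  unfold origamiSig
  split_ifs with h1 h2
  · omega
  · have := Nat.mod_le k (2 * t)
    omega
  · rfl

theorem origamiSig_lt {t k : ℕ} (hk : k < 2 * t) : origamiSig t k < 2 * t := by
  unfold origamiSig
  rw [Nat.mod_eq_of_lt hk]
  split_ifs <;> omega

/-- The `z`-slice of `s` consists of two points whose coordinates have opposite parities. -/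
def OrigamiSlice (s : Finset (ℕ × ℕ × ℕ)) (z : ℕ) : Prop :=
  ∃ a b c d : ℕ, a % 2 = 0 ∧ c % 2 = 1 ∧ b % 2 ≠ d % 2 ∧
    ∀ x y, (x, y, z) ∈ s ↔ (x = a ∧ y = b) ∨ (x = c ∧ y = d)

/-- Adjoining a parity-preserving image of `s`, shifted by `N` in the last coordinate,
keeps the slice structure. -/
theorem OrigamiSlice.union_image {s : Finset (ℕ × ℕ × ℕ)} {N : ℕ} {f g : ℕ → ℕ}
    (hf : ∀ k, f k % 2 = k % 2) (hg : ∀ k, g k % 2 = k % 2)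
    (hs : ∀ p ∈ s, p.2.2 < N) (h : ∀ z < N, OrigamiSlice s z) {z : ℕ} (hz : z < 2 * N) :
    OrigamiSlice (s ∪ s.image fun p => (f p.1, g p.2.1, p.2.2 + N)) z := by
  rcases lt_or_ge z N with hzN | hzN
  · obtain ⟨a, b, c, d, ha, hc, hbd, H⟩ := h z hzN
    refine ⟨a, b, c, d, ha, hc, hbd, fun x y => ?_⟩
    rw [← H, Finset.mem_union, or_iff_left]
    simp only [Finset.mem_image, Prod.mk.injEq, not_exists, not_and]
    intro p _ _ _
    omega
  · obtain ⟨a, b, c, d, ha, hc, hbd, H⟩ := h (z - N) (by omega)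
    refine ⟨f a, g b, f c, g d, (hf a).trans ha, (hf c).trans hc, by rwa [hg, hg], fun x y => ?_⟩
    rw [Finset.mem_union, or_iff_right fun hm => absurd (hs _ hm) (by simpa using hzN)]
    simp only [Finset.mem_image, Prod.mk.injEq, Prod.exists]
    constructor
    · rintro ⟨x', y', z', hm, rfl, rfl, rfl⟩
      rw [Nat.add_sub_cancel] at H
      rcases (H x' y').1 hm with ⟨rfl, rfl⟩ | ⟨rfl, rfl⟩ <;> simp
    · rintro (⟨rfl, rfl⟩ | ⟨rfl, rfl⟩)
      · exact ⟨a, b, z - N, (H a b).2 (Or.inl ⟨rfl, rfl⟩), rfl, rfl, by omega⟩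
      · exact ⟨c, d, z - N, (H c d).2 (Or.inr ⟨rfl, rfl⟩), rfl, rfl, by omega⟩

theorem two_pow_mod_two {k : ℕ} (hk : k ≠ 0) : 2 ^ k % 2 = 0 :=
  Nat.mod_eq_zero_of_dvd (dvd_pow_self 2 hk)

theorem origamiS_spec (n : ℕ) :
    (∀ p ∈ origamiS (n + 1), p.1 < 2 ^ ((n + 1) / 2 + 2) ∧
      p.2.1 < 2 ^ ((n + 1 + 1) / 2 + 1) ∧ p.2.2 < 2 ^ (n + 1 + 1)) ∧
    ∀ z < 2 ^ (n + 1 + 1), OrigamiSlice (origamiS (n + 1)) z := by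
  induction n with
  | zero =>
    refine ⟨by decide, fun z hz => ?_⟩
    norm_num at hz
    interval_cases z
    · exact ⟨0, 0, 1, 1, by simp [origamiS]⟩
    · exact ⟨2, 1, 3, 0, by simp [origamiS, or_comm]⟩
    · exact ⟨0, 2, 3, 3, by simp [origamiS]⟩
    · exact ⟨2, 3, 1, 2, by simp [origamiS]⟩
  | succ n ih =>
    obtain ⟨hb, hsl⟩ := ih
    rw [show origamiS (n + 1 + 1) =
      origamiS (n + 1) ∪ origamiFold (n + 1) (origamiS (n + 1)) from rfl]
    have hpow : 2 ^ (n + 1 + 1 + 1) = 2 * 2 ^ (n + 1 + 1) := pow_succ' _ _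
    unfold origamiFold
    rcases Nat.even_or_odd' n with ⟨k, rfl | rfl⟩
    · rw [if_pos (by omega)]
      rw [show (2 * k + 1) / 2 + 2 = k + 2 by omega,
        show (2 * k + 1 + 1) / 2 + 1 = k + 2 by omega] at hb
      rw [show (2 * k + 1 + 3) / 2 = k + 2 by omega, show (2 * k + 1 + 1) / 2 = k + 1 by omega,
        show k + 1 + 2 = k + 2 + 1 by omega, show (2 * k + 1 + 1 + 1) / 2 + 1 = k + 2 by omega]
      have hx : 2 ^ (k + 2 + 1) = 2 * 2 ^ (k + 2) := pow_succ' _ _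
      have hy : 2 ^ (k + 2) = 2 * 2 ^ (k + 1) := pow_succ' _ _
      refine ⟨fun p hp => ?_, fun z hz => ?_⟩
      · rcases Finset.mem_union.1 hp with hp | hp
        · have := hb p hp
          omega
        · obtain ⟨r, hr, rfl⟩ := Finset.mem_image.1 hp
          obtain ⟨h1, h2, h3⟩ := hb r hr
          have := origamiSig_lt (hy ▸ h2)
          dsimp only
          omega
      · refine OrigamiSlice.union_image (f := fun x => x + 2 ^ (k + 2)) (fun x => ?_)
          (origamiSig_mod_two (two_pow_mod_two (by omega))) (fun p hp => (hb p hp).2.2) hsl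
          (hpow ▸ hz)
        have := two_pow_mod_two (k := k + 2) (by omega)
        omega
    · rw [if_neg (by omega)]
      rw [show (2 * k + 1 + 1) / 2 + 2 = k + 2 + 1 by omega,
        show (2 * k + 1 + 1 + 1) / 2 + 1 = k + 2 by omega] at hb
      rw [show (2 * k + 1 + 1) / 2 + 1 = k + 2 by omega,
        show (2 * k + 1 + 1 + 1) / 2 + 2 = k + 2 + 1 by omega,
        show (2 * k + 1 + 1 + 1 + 1) / 2 + 1 = k + 2 + 1 by omega]
      have hx : 2 ^ (k + 2 + 1) = 2 * 2 ^ (k + 2) := pow_succ' _ _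
      refine ⟨fun p hp => ?_, fun z hz => ?_⟩
      · rcases Finset.mem_union.1 hp with hp | hp
        · have := hb p hp
          omega
        · obtain ⟨r, hr, rfl⟩ := Finset.mem_image.1 hp
          obtain ⟨h1, h2, h3⟩ := hb r hr
          have := origamiSig_lt (hx ▸ h1)
          dsimp only
          omega
      · refine OrigamiSlice.union_image (g := fun y => y + 2 ^ (k + 2))
          (origamiSig_mod_two (two_pow_mod_two (by omega))) (fun y => ?_)
          (fun p hp => (hb p hp).2.2) hsl (hpow ▸ hz)
        have := two_pow_mod_two (k := k + 2) (by omega)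
        omega

theorem origamiPFin_nonneg (n : ℕ) {lam : ℝ} (h0 : 0 < lam) (h1 : lam ≤ 1 / 2)
    (x : Fin (2 ^ (n / 2 + 2))) (y : Fin (2 ^ ((n + 1) / 2 + 1))) (z : Fin (2 ^ (n + 1))) :
    0 ≤ origamiPFin n lam x y z := by
  unfold origamiPFin origamiB
  split_ifs
  · positivity
  · exact div_nonneg (by linarith) (by positivity)
  · exact le_rfl

/-- Each `z`-slice of the origami distribution is supported on one point with even and one
point with odd first coordinate, differing in both coordinates. -/
theorem origamiPFin_slice {n : ℕ} (hn : 1 ≤ n) {lam : ℝ} (h0 : 0 < lam) (h1 : lam ≤ 1 / 2)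
    (z : Fin (2 ^ (n + 1))) :
    ∃ (a c : Fin (2 ^ (n / 2 + 2))) (b d : Fin (2 ^ ((n + 1) / 2 + 1))),
      (a : ℕ) % 2 = 0 ∧ (c : ℕ) % 2 = 1 ∧ b ≠ d ∧
      0 < origamiPFin n lam a b z ∧ 0 < origamiPFin n lam c d z ∧
      ∀ x y, origamiPFin n lam x y z ≠ 0 → (x = a ∧ y = b) ∨ (x = c ∧ y = d) := by
  obtain ⟨n, rfl⟩ := Nat.exists_eq_add_of_le' hn
  obtain ⟨hb, hsl⟩ := origamiS_spec n
  obtain ⟨a, b, c, d, ha, hc, hbd, H⟩ := hsl z z.2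
  have hab := (H a b).2 (Or.inl ⟨rfl, rfl⟩)
  have hcd := (H c d).2 (Or.inr ⟨rfl, rfl⟩)
  refine ⟨⟨a, (hb _ hab).1⟩, ⟨c, (hb _ hcd).1⟩, ⟨b, (hb _ hab).2.1⟩, ⟨d, (hb _ hcd).2.1⟩,
    ha, hc, fun h => hbd (by rw [Fin.mk.inj h]), ?_, ?_, fun x y hxy => ?_⟩
  · simp only [origamiPFin, origamiB, if_pos hab, if_pos ha]
    positivity
  · simp only [origamiPFin, origamiB, if_pos hcd, hc]
    exact div_pos (by norm_num; linarith) (by positivity)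
  · simp only [origamiPFin, origamiB, ne_eq, ite_eq_right_iff, not_forall] at hxy
    simpa only [Fin.ext_iff] using (H x y).1 hxy.1

/-- A function supported at a single point is the product of its marginals, up to its total
mass. -/
theorem mul_sum_eq_of_support_subset_singleton {X Y : Type*} [Fintype X] [Fintype Y]
    (f : X → Y → ℝ) (a : X) (b : Y) (h : ∀ x y, f x y ≠ 0 → x = a ∧ y = b) (x : X) (y : Y) :
    f x y * ∑ x', ∑ y', f x' y' = (∑ y', f x y') * ∑ x', f x' y := by
  have hrow : ∀ x, ∑ y', f x y' = f x b := fun x =>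
    Fintype.sum_eq_single b fun y hy => by_contra fun hne => hy (h x y hne).2
  have hcol : ∑ x', f x' y = f a y :=
    Fintype.sum_eq_single a fun x hx => by_contra fun hne => hx (h x y hne).1
  have htot : ∑ x', f x' b = f a b :=
    Fintype.sum_eq_single a fun x hx => by_contra fun hne => hx (h x b hne).1
  simp only [hrow, hcol, htot]
  by_cases hx : x = a
  · subst hx
    ring
  · have hzero : ∀ y, f x y = 0 := fun y => by_contra fun hne => hx (h x y hne).1
    simp [hzero]

open scoped Classical in
/-- If `f` is a mixture over `w` of product functions and has positive values at `(a, b)` and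
`(c, d)` but vanishes at `(a, d)`, then at least two values of `w` carry mass. -/
theorem two_le_card_of_condIndep {X Y : Type*} [Fintype X] [Fintype Y] {m : ℕ}
    {f : X → Y → ℝ} {q : X → Y → Fin m → ℝ} (hq : ∀ x y w, 0 ≤ q x y w)
    (hsum : ∀ x y, ∑ w, q x y w = f x y)
    (hind : ∀ x y w, q x y w * (∑ x', ∑ y', q x' y' w) =
      (∑ y', q x y' w) * (∑ x', q x' y w))
    {a c : X} {b d : Y} (hab : 0 < f a b) (hcd : 0 < f c d) (had : f a d = 0) :
    2 ≤ (Finset.univ.filter fun w : Fin m => 0 < ∑ x, ∑ y, q x y w).card := by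
  have hrow : ∀ x y w, q x y w ≤ ∑ y', q x y' w := fun x y w =>
    Finset.single_le_sum (f := fun y' => q x y' w) (fun y' _ => hq x y' w) (Finset.mem_univ y)
  have hcol : ∀ x y w, q x y w ≤ ∑ x', q x' y w := fun x y w =>
    Finset.single_le_sum (f := fun x' => q x' y w) (fun x' _ => hq x' y w) (Finset.mem_univ x)
  have htot : ∀ x y w, q x y w ≤ ∑ x', ∑ y', q x' y' w := fun x y w =>
    (hrow x y w).trans <| Finset.single_le_sum (f := fun x' => ∑ y', q x' y' w)
      (fun x' _ => Finset.sum_nonneg fun y' _ => hq x' y' w) (Finset.mem_univ x)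
  rw [← hsum] at hab hcd had
  obtain ⟨w, -, hw⟩ := Finset.exists_lt_of_sum_lt (by simpa using hab :
    ∑ _w : Fin m, (0 : ℝ) < ∑ w, q a b w)
  obtain ⟨w', -, hw'⟩ := Finset.exists_lt_of_sum_lt (by simpa using hcd :
    ∑ _w : Fin m, (0 : ℝ) < ∑ w, q c d w)
  refine Finset.one_lt_card.2 ⟨w, ?_, w', ?_, ?_⟩
  · simpa using hw.trans_le (htot a b w)
  · simpa using hw'.trans_le (htot c d w')
  · rintro rfl
    have hzero : q a d w = 0 :=
      (Finset.sum_eq_zero_iff_of_nonneg fun w _ => hq a d w).1 had w (Finset.mem_univ w)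
    have := hind a d w
    rw [hzero, zero_mul] at this
    exact (mul_pos (hw.trans_le (hrow a b w)) (hw'.trans_le (hcol c d w))).ne this

open scoped Classical in
/-- The secrecy rank of the origami distribution `b^{(n,λ)}` equals `2`. In particular,
any auxiliary variable `W` making `X` and `Y` conditionally independent given `(Z,W)`
must take at least two values of positive probability given `Z = z` for every `z` in the
support of the `Z`-marginal, and the choice `W = (parity of X)` attains the value `2`. -/
theorem origami_secrecy_rank
    (n : ℕ) (hn : 1 ≤ n) (lam : ℝ) (hlam0 : 0 < lam) (hlam1 : lam ≤ 1 / 2) :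
    Srk (origamiPFin n lam) = 2 ∧
    (∀ m : ℕ, 1 ≤ m →
      ∀ q : Fin (2 ^ (n / 2 + 2)) → Fin (2 ^ ((n + 1) / 2 + 1)) →
          Fin (2 ^ (n + 1)) → Fin m → ℝ,
        (∀ x y z w, 0 ≤ q x y z w) →
        (∀ x y z, ∑ w, q x y z w = origamiPFin n lam x y z) →
        (∀ x y z w, q x y z w * (∑ x', ∑ y', q x' y' z w) =
          (∑ y', q x y' z w) * (∑ x', q x' y z w)) →
        ∀ z, (0 < ∑ x, ∑ y, origamiPFin n lam x y z) →
          2 ≤ (Finset.univ.filter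
            fun w : Fin m => 0 < ∑ x, ∑ y, q x y z w).card) ∧
    ((∀ x y z w, 0 ≤ origamiQPar n lam x y z w) ∧
      (∀ x y z, ∑ w, origamiQPar n lam x y z w = origamiPFin n lam x y z) ∧
      (∀ x y z w, origamiQPar n lam x y z w * (∑ x', ∑ y', origamiQPar n lam x' y' z w) =
        (∑ y', origamiQPar n lam x y' z w) * (∑ x', origamiQPar n lam x' y z w)) ∧
      (Finset.univ.filter
          fun z : Fin (2 ^ (n + 1)) => 0 < ∑ x, ∑ y, origamiPFin n lam x y z).sup
        (fun z => (Finset.univ.filter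
          fun w : Fin 2 => 0 < ∑ x, ∑ y, origamiQPar n lam x y z w).card) = 2) := by
  have hlower : ∀ m : ℕ, ∀ q : Fin (2 ^ (n / 2 + 2)) → Fin (2 ^ ((n + 1) / 2 + 1)) →
          Fin (2 ^ (n + 1)) → Fin m → ℝ,
        (∀ x y z w, 0 ≤ q x y z w) →
        (∀ x y z, ∑ w, q x y z w = origamiPFin n lam x y z) →
        (∀ x y z w, q x y z w * (∑ x', ∑ y', q x' y' z w) =
          (∑ y', q x y' z w) * (∑ x', q x' y z w)) →
        ∀ z, 2 ≤ (Finset.univ.filter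
            fun w : Fin m => 0 < ∑ x, ∑ y, q x y z w).card := by
    intro m q hq hsum hind z
    obtain ⟨a, c, b, d, ha, hc, hbd, hab, hcd, hsupp⟩ := origamiPFin_slice hn hlam0 hlam1 z
    refine two_le_card_of_condIndep (fun x y w => hq x y z w) (fun x y => hsum x y z)
      (fun x y w => hind x y z w) hab hcd (by_contra fun hne => ?_)
    rcases hsupp _ _ hne with ⟨-, h⟩ | ⟨rfl, -⟩
    · exact hbd h.symm
    · omega
  obtain ⟨z₀, hz₀⟩ : ∃ z, 0 < ∑ x, ∑ y, origamiPFin n lam x y z := by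
    obtain ⟨a, -, b, -, -, -, -, hab, -⟩ :=
      origamiPFin_slice hn hlam0 hlam1 ⟨0, by positivity⟩
    have hp := origamiPFin_nonneg n hlam0 hlam1
    exact ⟨_, Finset.sum_pos' (fun x _ => Finset.sum_nonneg fun y _ => hp x y _)
      ⟨a, Finset.mem_univ a, Finset.sum_pos' (fun y _ => hp a y _)
        ⟨b, Finset.mem_univ b, hab⟩⟩⟩
  have hq : ∀ x y z w, 0 ≤ origamiQPar n lam x y z w := by
    intro x y z w
    unfold origamiQPar
    split_ifs
    · exact origamiPFin_nonneg n hlam0 hlam1 x y z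
    · exact le_rfl
  have hsum : ∀ x y z, ∑ w, origamiQPar n lam x y z w = origamiPFin n lam x y z := by
    intro x y z
    rcases Nat.mod_two_eq_zero_or_one x with h | h <;> simp [origamiQPar, h]
  have hind : ∀ x y z w,
      origamiQPar n lam x y z w * (∑ x', ∑ y', origamiQPar n lam x' y' z w) =
        (∑ y', origamiQPar n lam x y' z w) * (∑ x', origamiQPar n lam x' y z w) := by
    intro x y z w
    obtain ⟨a, c, b, d, ha, hc, -, -, -, hsupp⟩ := origamiPFin_slice hn hlam0 hlam1 z
    have hQ : ∀ x y, origamiQPar n lam x y z w ≠ 0 →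
        (x : ℕ) % 2 = w ∧ ((x = a ∧ y = b) ∨ (x = c ∧ y = d)) := by
      intro x y hxy
      simp only [origamiQPar, ne_eq, ite_eq_right_iff, not_forall] at hxy
      exact ⟨hxy.1, hsupp x y hxy.2⟩
    by_cases hw : (w : ℕ) = 0
    · refine mul_sum_eq_of_support_subset_singleton (origamiQPar n lam · · z w) a b
        (fun x y hxy => ?_) x y
      obtain ⟨hx, h | ⟨rfl, -⟩⟩ := hQ x y hxy
      · exact h
      · omega
    · refine mul_sum_eq_of_support_subset_singleton (origamiQPar n lam · · z w) c d
        (fun x y hxy => ?_) x y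
      obtain ⟨hx, ⟨rfl, -⟩ | h⟩ := hQ x y hxy
      · omega
      · exact h
  have hsup : (Finset.univ.filter
          fun z : Fin (2 ^ (n + 1)) => 0 < ∑ x, ∑ y, origamiPFin n lam x y z).sup
        (fun z => (Finset.univ.filter
          fun w : Fin 2 => 0 < ∑ x, ∑ y, origamiQPar n lam x y z w).card) = 2 := by
    refine le_antisymm (Finset.sup_le fun z _ => ?_) ?_
    · simpa using Finset.card_le_univ
        (Finset.univ.filter fun w : Fin 2 => 0 < ∑ x, ∑ y, origamiQPar n lam x y z w)
    · exact Finset.le_sup_of_le (b := z₀) (by simpa using hz₀) (hlower 2 _ hq hsum hind z₀)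
  refine ⟨?_, fun m _ q hq hsum hind z _ => hlower m q hq hsum hind z, hq, hsum, hind, hsup⟩
  have hmem : 2 ∈ {r : ℕ | ∃ m : ℕ, 1 ≤ m ∧ ∃ q : Fin (2 ^ (n / 2 + 2)) →
      Fin (2 ^ ((n + 1) / 2 + 1)) → Fin (2 ^ (n + 1)) → Fin m → ℝ,
      (∀ x y z w, 0 ≤ q x y z w) ∧
      (∀ x y z, ∑ w, q x y z w = origamiPFin n lam x y z) ∧
      (∀ x y z w, q x y z w * (∑ x', ∑ y', q x' y' z w) =
        (∑ y', q x y' z w) * (∑ x', q x' y z w)) ∧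
      r = (Finset.univ.filter fun z => 0 < ∑ x, ∑ y, origamiPFin n lam x y z).sup
        (fun z => (Finset.univ.filter fun w : Fin m => 0 < ∑ x, ∑ y, q x y z w).card)} :=
    ⟨2, one_le_two, origamiQPar n lam, hq, hsum, hind, hsup.symm⟩
  refine le_antisymm (Nat.sInf_le hmem) (le_csInf ⟨2, hmem⟩ ?_)
  rintro r ⟨m, -, q, hq', hsum', hind', rfl⟩
  exact Finset.le_sup_of_le (b := z₀) (by simpa using hz₀) (hlower m q hq' hsum' hind' z₀)
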